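/- For every Lebesgue integrable function f on the circle T = R/Z, the sequence of Riemann sums R_n f = (1/n) Σ_{j=0}^{n-1} f(· + j/n) converges in L¹ norm to the constant function equal to ∫_T f dρ. -/

import Mathlib

open MeasureTheory Filter Topology

/-- The Riemann sum. -/
noncomputable def rsum (n : ℕ) (f : UnitAddCircle → ℂ) (x : UnitAddCircle) : ℂ :=
  (n : ℂ)⁻¹ * ∑ j ∈ Finset.range n, f (x + (((j : ℝ) / (n : ℝ) : ℝ) : UnitAddCircle))

/-- The L¹ error. -/
noncomputable def rerr (n : ℕ) (f : UnitAddCircle → ℂ) : ℝ :=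
  ∫ x : UnitAddCircle, ‖rsum n f x - ∫ y : UnitAddCircle, f y‖

lemma vol_real_univ : (volume : Measure UnitAddCircle).real Set.univ = 1 := by
  simp [Measure.real, UnitAddCircle.measure_univ]

lemma rsum_integrable (n : ℕ) {f : UnitAddCircle → ℂ} (hf : Integrable f volume) :
    Integrable (rsum n f) volume := by
  unfold rsum
  apply Integrable.const_mul
  apply integrable_finsetSum
  intro j _
  exact hf.comp_add_right _

lemma rsum_norm_le (n : ℕ) {f : UnitAddCircle → ℂ} (hf : Integrable f volume) :
    ∫ x, ‖rsum n f x‖ ≤ ∫ x, ‖f x‖ := by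
  have hi : ∀ j ∈ Finset.range n, Integrable (fun x : UnitAddCircle =>
      ‖f (x + (((j : ℝ) / (n : ℝ) : ℝ) : UnitAddCircle))‖) volume :=
    fun j _ => (hf.comp_add_right _).norm
  calc ∫ x, ‖rsum n f x‖ ≤ ∫ x, (n : ℝ)⁻¹ * ∑ j ∈ Finset.range n,
        ‖f (x + (((j : ℝ) / (n : ℝ) : ℝ) : UnitAddCircle))‖ := by
        apply integral_mono (rsum_integrable n hf).norm
        · exact (integrable_finsetSum _ hi).const_mul _
        · intro x
          simp only [rsum, norm_mul, norm_inv, Complex.norm_natCast]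
          gcongr
          exact norm_sum_le _ _
    _ = (n : ℝ)⁻¹ * ∑ j ∈ Finset.range n, ∫ x, ‖f x‖ := by
        rw [integral_const_mul, integral_finsetSum _ hi]
        congr 1
        apply Finset.sum_congr rfl
        intro j _
        exact integral_add_right_eq_self (fun x => ‖f x‖) _
    _ ≤ ∫ x, ‖f x‖ := by
        have h0 : 0 ≤ ∫ x, ‖f x‖ := integral_nonneg fun x => norm_nonneg _
        rcases Nat.eq_zero_or_pos n with rfl | hn
        · simpa using h0
        · have : (n : ℝ) ≠ 0 := by positivity
          simp [this]

lemma rerr_nonneg (n : ℕ) (f : UnitAddCircle → ℂ) : 0 ≤ rerr n f :=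
  integral_nonneg fun _ => norm_nonneg _

lemma rerr_le (n : ℕ) {f : UnitAddCircle → ℂ} (hf : Integrable f volume) :
    rerr n f ≤ 2 * ∫ x, ‖f x‖ := by
  calc rerr n f ≤ ∫ x : UnitAddCircle, (‖rsum n f x‖ + ‖∫ y, f y‖) := by
        apply integral_mono ((rsum_integrable n hf).sub (integrable_const _)).norm
          ((rsum_integrable n hf).norm.add (integrable_const _))
        intro x
        exact norm_sub_le _ _
    _ = (∫ x, ‖rsum n f x‖) + ‖∫ y, f y‖ := by
        rw [integral_add (rsum_integrable n hf).norm (integrable_const _)]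
        simp [vol_real_univ]
    _ ≤ _ := by
        have := rsum_norm_le n hf
        have := norm_integral_le_integral_norm (μ := volume) f
        linarith

lemma rerr_add (n : ℕ) {f g : UnitAddCircle → ℂ} (hf : Integrable f volume)
    (hg : Integrable g volume) : rerr n (f + g) ≤ rerr n f + rerr n g := by
  have h1 : Integrable (fun x => ‖rsum n f x - ∫ y, f y‖) volume :=
    ((rsum_integrable n hf).sub (integrable_const (∫ y, f y))).norm
  have h2 : Integrable (fun x => ‖rsum n g x - ∫ y, g y‖) volume :=
    ((rsum_integrable n hg).sub (integrable_const (∫ y, g y))).norm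
  unfold rerr
  rw [← integral_add h1 h2]
  apply integral_mono ((rsum_integrable n (hf.add hg)).sub (integrable_const _)).norm (h1.add h2)
  intro x
  have : rsum n (f + g) x - ∫ y, (f + g) y
      = (rsum n f x - ∫ y, f y) + (rsum n g x - ∫ y, g y) := by
    rw [integral_add' hf hg]
    simp only [rsum, Pi.add_apply, Finset.sum_add_distrib]
    ring
  change ‖rsum n (f + g) x - ∫ y, (f + g) y‖ ≤ _
  rw [this]
  exact norm_add_le _ _

lemma rerr_smul (n : ℕ) (c : ℂ) (f : UnitAddCircle → ℂ) :
    rerr n (c • f) = ‖c‖ * rerr n f := by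
  unfold rerr
  rw [← integral_const_mul]
  congr 1
  ext x
  rw [← norm_mul]
  congr 1
  simp only [rsum, Pi.smul_apply, smul_eq_mul, integral_const_mul, ← Finset.mul_sum]
  ring

lemma integral_fourier_zero {k : ℤ} (hk : k ≠ 0) :
    ∫ x : UnitAddCircle, fourier k x = 0 := by
  have h := integral_add_right_eq_self (μ := (volume : Measure UnitAddCircle))
    (fun x => (fourier k x : ℂ)) (((1 : ℝ) / 2 / k : ℝ) : UnitAddCircle)
  simp only [fourier_add_half_inv_index hk one_pos, integral_neg] at h
  have h2 : (2 : ℂ) * ∫ x : UnitAddCircle, (fourier k x : ℂ) = 0 := by linear_combination -h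
  simpa using h2

lemma rsum_fourier {k : ℤ} (hk : k ≠ 0) {n : ℕ} (hn : k.natAbs < n) (x : UnitAddCircle) :
    rsum n (fourier k) x = 0 := by
  have hn0 : (n : ℂ) ≠ 0 := by exact_mod_cast (by omega : n ≠ 0)
  set z : ℂ := Complex.exp (2 * Real.pi * Complex.I * k / n) with hz
  have h1 : ∀ j : ℕ, (fourier k (x + (((j : ℝ) / (n : ℝ) : ℝ) : UnitAddCircle)) : ℂ)
      = fourier k x * z ^ j := by
    intro j
    rw [fourier_apply, smul_add, AddCircle.toCircle_add, Circle.coe_mul, ← fourier_apply,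
      ← fourier_apply, fourier_coe_apply, hz, ← Complex.exp_nat_mul]
    congr 2
    push_cast
    field_simp
  have hzn : z ^ n = 1 := by
    rw [hz, ← Complex.exp_nat_mul, Complex.exp_eq_one_iff]
    exact ⟨k, by field_simp⟩
  have hz1 : z ≠ 1 := by
    rw [hz, Ne, Complex.exp_eq_one_iff]
    rintro ⟨m, hm⟩
    have hpi := Complex.two_pi_I_ne_zero
    have h3 : (k : ℂ) = m * n := by
      field_simp at hm
      rw [hm, mul_comm]
    have h4 : k = m * n := by exact_mod_cast h3
    have h5 : (n : ℤ) ∣ k := ⟨m, by rw [h4, mul_comm]⟩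
    have h6 := Int.natAbs_dvd_natAbs.2 h5
    have h7 := Nat.le_of_dvd (by omega) h6
    simp at h7
    omega
  unfold rsum
  simp only [h1]
  rw [← Finset.mul_sum, geom_sum_eq hz1, hzn]
  simp

lemma rerr_fourier (k : ℤ) :
    Tendsto (fun n : ℕ => rerr n (fourier k : C(UnitAddCircle, ℂ))) atTop (𝓝 0) := by
  apply tendsto_const_nhds.congr'
  filter_upwards [eventually_gt_atTop k.natAbs] with n hn
  rcases eq_or_ne k 0 with rfl | hk
  · have hn0 : (n : ℂ) ≠ 0 := by exact_mod_cast (by omega : n ≠ 0)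
    simp [rerr, rsum, hn0, vol_real_univ]
  · simp only [rerr, rsum_fourier hk hn, integral_fourier_zero hk, sub_zero, norm_zero,
      integral_zero]

lemma cont_integrable (g : C(UnitAddCircle, ℂ)) : Integrable g volume :=
  g.continuous.integrable_of_hasCompactSupport (HasCompactSupport.of_compactSpace _)

lemma rerr_span (g : C(UnitAddCircle, ℂ))
    (hg : g ∈ Submodule.span ℂ (Set.range (fourier (T := (1 : ℝ))))) :
    Tendsto (fun n : ℕ => rerr n g) atTop (𝓝 0) := by
  induction hg using Submodule.span_induction with
  | mem x hx =>
    obtain ⟨k, rfl⟩ := hx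
    exact rerr_fourier k
  | zero => simp [rerr, rsum]
  | add x y _ _ hx hy =>
    refine squeeze_zero (fun n => rerr_nonneg n _) (fun n => ?_) (by simpa using hx.add hy)
    exact rerr_add n (cont_integrable x) (cont_integrable y)
  | smul c x _ hx =>
    have : ∀ n, rerr n (c • x : C(UnitAddCircle, ℂ)) = ‖c‖ * rerr n x :=
      fun n => rerr_smul n c x
    simp only [this]
    simpa using hx.const_mul ‖c‖

lemma exists_span_approx (f : UnitAddCircle → ℂ) (hf : Integrable f volume) {ε : ℝ}
    (hε : 0 < ε) : ∃ g ∈ Submodule.span ℂ (Set.range (fourier (T := (1 : ℝ)))),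
      ∫ x, ‖f x - g x‖ ≤ ε := by
  obtain ⟨g, -, hg, hgc, -⟩ := hf.exists_hasCompactSupport_integral_sub_le (half_pos hε)
  let G : C(UnitAddCircle, ℂ) := ⟨g, hgc⟩
  have hG : G ∈ closure ((Submodule.span ℂ (Set.range (fourier (T := (1 : ℝ)))) :
      Submodule ℂ C(UnitAddCircle, ℂ)) : Set C(UnitAddCircle, ℂ)) := by
    rw [← Submodule.topologicalClosure_coe, span_fourier_closure_eq_top]
    trivial
  obtain ⟨h, hh, hd⟩ := Metric.mem_closure_iff.1 hG (ε / 2) (half_pos hε)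
  refine ⟨h, hh, ?_⟩
  have i1 : Integrable (fun x => ‖f x - g x‖) volume := (hf.sub (cont_integrable G)).norm
  calc ∫ x, ‖f x - h x‖ ≤ ∫ x, (‖f x - g x‖ + ε / 2) := by
        apply integral_mono (hf.sub (cont_integrable h)).norm (i1.add (integrable_const _))
        intro x
        have h1 : ‖g x - h x‖ ≤ ε / 2 := by
          rw [← dist_eq_norm]
          exact (ContinuousMap.dist_apply_le_dist (f := G) (g := h) x).trans hd.le
        change ‖f x - h x‖ ≤ ‖f x - g x‖ + ε / 2
        have := norm_sub_le_norm_sub_add_norm_sub (f x) (g x) (h x)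
        linarith
    _ = (∫ x, ‖f x - g x‖) + ε / 2 := by
        rw [integral_add i1 (integrable_const _)]
        simp [vol_real_univ]
    _ ≤ ε := by linarith

/-- For every Lebesgue integrable `f` on the circle `T = ℝ/ℤ`, the
Riemann sums `R_n f = (1/n) ∑_{j<n} f(· + j/n)` converge in `L¹` norm to the constant
function `∫_T f dρ`. -/
theorem riemann_sums_L1_convergence (f : UnitAddCircle → ℂ)
    (hf : Integrable f volume) :
    Tendsto (fun n : ℕ =>
        ∫ x : UnitAddCircle,
          ‖(n : ℂ)⁻¹ * ∑ j ∈ Finset.range n, f (x + (((j : ℝ) / (n : ℝ) : ℝ) : UnitAddCircle))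
            - ∫ y : UnitAddCircle, f y‖)
      atTop (𝓝 0) := by
  change Tendsto (fun n : ℕ => rerr n f) atTop (𝓝 0)
  rw [Metric.tendsto_atTop']
  intro ε hε
  obtain ⟨g, hg, hfg⟩ := exists_span_approx f hf (by positivity : 0 < ε / 4)
  obtain ⟨N, hN⟩ := Metric.tendsto_atTop'.1 (rerr_span g hg) (ε / 2) (half_pos hε)
  refine ⟨N, fun n hn => ?_⟩
  have h1 := hN n hn
  rw [Real.dist_eq, sub_zero, abs_of_nonneg (rerr_nonneg _ _)] at h1 ⊢
  have hi : Integrable (f - (g : UnitAddCircle → ℂ)) volume := hf.sub (cont_integrable g)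
  have h2 := rerr_add n (cont_integrable g) hi
  have h3 := rerr_le n hi
  rw [add_sub_cancel] at h2
  simp only [Pi.sub_apply] at h3
  linarith
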